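/- arXiv:2401.02005 — 3 statements merged into one kernel-verified Lean document; each statement's English description precedes it below -/
import Mathlib

section
/- Let R be a unique factorization domain, N a natural number, and F ∈ R[X₀,…,X_N] an irreducible homogeneous polynomial of degree D > 0. Let S be the subring of the fraction field of R[X₀,…,X_N] consisting of 0 together with all elements of the form P/F^m, where m ≥ 0 and P ∈ R[X₀,…,X_N] is a nonzero homogeneous polynomial of degree m·D. Then every unit of the ring S is the image of a unit of R; that is, S^× = R^×. -/
open MvPolynomial

/-- Let `R` be a UFD, `F ∈ R[X₀,…,X_N]` an irreducible homogeneous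
polynomial of degree `D > 0`, and let `S` be the subset of the fraction field of
`R[X₀,…,X_N]` consisting of `0` together with all `P / F^m` with `P` nonzero homogeneous
of degree `m * D` (the ring of regular functions on `ℙ^N_R ∖ V(F)`).  Then the units of
`S` are exactly the images of the units of `R`: an element of `S` has a multiplicative
inverse in `S` iff it is the image of a unit of `R`. -/
theorem stmt0 (R : Type*) [CommRing R] [IsDomain R] [UniqueFactorizationMonoid R]
    (N : ℕ) (D : ℕ) (hD : 0 < D)
    (F : MvPolynomial (Fin (N + 1)) R) (hFirr : Irreducible F)
    (hFhom : F.IsHomogeneous D)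
    (S : Set (FractionRing (MvPolynomial (Fin (N + 1)) R)))
    (hS : S = {x | x = 0 ∨ ∃ (m : ℕ) (P : MvPolynomial (Fin (N + 1)) R),
      P ≠ 0 ∧ P.IsHomogeneous (m * D) ∧
      x = algebraMap (MvPolynomial (Fin (N + 1)) R)
            (FractionRing (MvPolynomial (Fin (N + 1)) R)) P /
          (algebraMap (MvPolynomial (Fin (N + 1)) R)
            (FractionRing (MvPolynomial (Fin (N + 1)) R)) F) ^ m})
    (x : FractionRing (MvPolynomial (Fin (N + 1)) R)) :
    (x ∈ S ∧ ∃ y ∈ S, x * y = 1) ↔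
      ∃ r : Rˣ, x = algebraMap (MvPolynomial (Fin (N + 1)) R)
        (FractionRing (MvPolynomial (Fin (N + 1)) R)) (MvPolynomial.C (r : R)) := by
  subst hS
  have hF0 : F ≠ 0 := hFirr.ne_zero
  have hinj : Function.Injective (algebraMap (MvPolynomial (Fin (N + 1)) R)
      (FractionRing (MvPolynomial (Fin (N + 1)) R))) := IsFractionRing.injective _ _
  have hf0 : algebraMap (MvPolynomial (Fin (N + 1)) R)
      (FractionRing (MvPolynomial (Fin (N + 1)) R)) F ≠ 0 := by
    intro h
    exact hF0 (hinj (by rw [h, map_zero]))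
  constructor
  · rintro ⟨hx, y, hy, hxy⟩
    rcases hx with hx | ⟨m, P, hP0, hP, hx⟩
    · rw [hx, zero_mul] at hxy
      exact absurd hxy zero_ne_one
    rcases hy with hy | ⟨k, Q, hQ0, hQ, hy⟩
    · rw [hy, mul_zero] at hxy
      exact absurd hxy zero_ne_one
    have hPQ : P * Q = F ^ (m + k) := by
      apply hinj
      rw [hx, hy, div_mul_div_comm, ← pow_add,
        div_eq_one_iff_eq (pow_ne_zero _ hf0)] at hxy
      rw [map_mul, map_pow, hxy]
    have hprime : Prime F := hFirr.prime
    obtain ⟨i, -, hi⟩ := (dvd_prime_pow hprime (m + k)).1 (Dvd.intro _ hPQ)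
    obtain ⟨u, hu⟩ := hi.symm
    obtain ⟨r, hr, hru⟩ := MvPolynomial.isUnit_iff_eq_C_of_isReduced.1 u.isUnit
    have hFi : (F ^ i * (u : MvPolynomial (Fin (N + 1)) R)).IsHomogeneous (D * i + 0) := by
      rw [hru]
      exact (hFhom.pow i).mul (isHomogeneous_C _ r)
    rw [hu] at hFi
    have hdeg := hFi.inj_right hP hP0
    have him : i = m := by
      apply Nat.eq_of_mul_eq_mul_left hD
      rw [Nat.mul_comm m D] at hdeg
      simpa using hdeg
    subst him
    refine ⟨hr.unit, ?_⟩
    rw [hx, ← hu, hru, map_mul, map_pow, mul_div_cancel_left₀ _ (pow_ne_zero _ hf0)]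
    rfl
  · have key : ∀ r : Rˣ, algebraMap (MvPolynomial (Fin (N + 1)) R)
        (FractionRing (MvPolynomial (Fin (N + 1)) R)) (MvPolynomial.C (r : R)) ∈
        {x | x = 0 ∨ ∃ (m : ℕ) (P : MvPolynomial (Fin (N + 1)) R),
      P ≠ 0 ∧ P.IsHomogeneous (m * D) ∧
      x = algebraMap (MvPolynomial (Fin (N + 1)) R)
            (FractionRing (MvPolynomial (Fin (N + 1)) R)) P /
          (algebraMap (MvPolynomial (Fin (N + 1)) R)
            (FractionRing (MvPolynomial (Fin (N + 1)) R)) F) ^ m} := by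
      intro r
      refine Or.inr ⟨0, MvPolynomial.C (r : R), ?_, ?_, ?_⟩
      · rw [Ne, MvPolynomial.C_eq_zero]
        exact r.ne_zero
      · rw [zero_mul]
        exact isHomogeneous_C _ _
      · rw [pow_zero, div_one]
    rintro ⟨r, rfl⟩
    refine ⟨key r, _, key r⁻¹, ?_⟩
    rw [← map_mul, ← map_mul, Units.mul_inv, map_one, map_one]
end

section
/- The sequence of functions Z ↦ d^{−n}·log ‖F^n(Z)‖, n ∈ ℕ, converges uniformly on ℂ² ∖ {(0,0)} to a continuous function G^F : ℂ² ∖ {(0,0)} → ℝ (called the escaping rate function of F). -/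
open Filter Finset MvPolynomial

/-- Evaluation of a bivariate polynomial at a point of `ℂ²`. -/
noncomputable def ev (P : MvPolynomial (Fin 2) ℂ) (Z : ℂ × ℂ) : ℂ :=
  MvPolynomial.eval ![Z.1, Z.2] P

/-- The self-map of `ℂ²` determined by the pair `F = (F₀, F₁)`. -/
noncomputable def Fmap (F₀ F₁ : MvPolynomial (Fin 2) ℂ) (Z : ℂ × ℂ) : ℂ × ℂ :=
  (ev F₀ Z, ev F₁ Z)

/-- The Euclidean norm on `ℂ²`. -/
noncomputable def enorm2 (Z : ℂ × ℂ) : ℝ := Real.sqrt (‖Z.1‖ ^ 2 + ‖Z.2‖ ^ 2)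

lemma ev_smul {d : ℕ} {P : MvPolynomial (Fin 2) ℂ} (h : P.IsHomogeneous d) (c : ℂ) (Z : ℂ × ℂ) :
    ev P (c • Z) = c ^ d * ev P Z := by
  unfold ev
  rw [MvPolynomial.eval_eq', MvPolynomial.eval_eq', Finset.mul_sum]
  refine Finset.sum_congr rfl fun m hm => ?_
  have := h (MvPolynomial.mem_support_iff.mp hm)
  have hdeg : m 0 + m 1 = d := by
    rw [← this]
    simp [Finsupp.weight_apply, Finsupp.sum_fintype, Fin.sum_univ_two]
  simp only [Fin.prod_univ_two, Matrix.cons_val_zero, Matrix.cons_val_one, Prod.smul_fst,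
    Prod.smul_snd, smul_eq_mul, mul_pow]
  rw [← hdeg, pow_add]
  ring

lemma ev_cont (P : MvPolynomial (Fin 2) ℂ) : Continuous (ev P) := by
  unfold ev
  have h1 := MvPolynomial.continuous_eval P
  refine h1.comp ?_
  refine continuous_pi fun i => ?_
  fin_cases i
  · exact continuous_fst
  · exact continuous_snd

lemma enorm2_smul (c : ℂ) (Z : ℂ × ℂ) : enorm2 (c • Z) = ‖c‖ * enorm2 Z := by
  unfold enorm2
  simp only [Prod.smul_fst, Prod.smul_snd, smul_eq_mul, norm_mul, mul_pow]
  rw [← mul_add, Real.sqrt_mul (by positivity), Real.sqrt_sq (norm_nonneg _)]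

lemma enorm2_cont : Continuous enorm2 := by
  unfold enorm2
  fun_prop

lemma enorm2_pos {Z : ℂ × ℂ} (h : Z ≠ 0) : 0 < enorm2 Z := by
  unfold enorm2
  apply Real.sqrt_pos.mpr
  by_cases h1 : Z.1 = 0
  · have h2 : Z.2 ≠ 0 := fun h2 => h (Prod.ext h1 h2)
    have := norm_pos_iff.mpr h2
    positivity
  · have := norm_pos_iff.mpr h1
    positivity

lemma Fmap_bound (d : ℕ) (F₀ F₁ : MvPolynomial (Fin 2) ℂ)
    (h₀ : F₀.IsHomogeneous d) (h₁ : F₁.IsHomogeneous d)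
    (hne : ∀ Z : ℂ × ℂ, Z ≠ 0 → Fmap F₀ F₁ Z ≠ 0) :
    ∃ C : ℝ, ∀ Z : ℂ × ℂ, Z ≠ 0 →
      |Real.log (enorm2 (Fmap F₀ F₁ Z)) - d * Real.log (enorm2 Z)| ≤ C := by
  have hFc : Continuous (Fmap F₀ F₁) := (ev_cont F₀).prodMk (ev_cont F₁)
  have hK : IsCompact (Metric.sphere (0 : ℂ × ℂ) 1) := isCompact_sphere _ _
  have hs : ∀ Z ∈ Metric.sphere (0 : ℂ × ℂ) 1, Z ≠ 0 := by
    rintro Z hZ rfl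
    simp at hZ
  obtain ⟨C, hC⟩ := hK.exists_bound_of_continuousOn
    (f := fun Z => Real.log (enorm2 (Fmap F₀ F₁ Z)) - d * Real.log (enorm2 Z)) (by
      refine ContinuousOn.sub ?_ (continuousOn_const.mul ?_)
      · exact (enorm2_cont.comp hFc).continuousOn.log
          fun Z hZ => (enorm2_pos (hne Z (hs Z hZ))).ne'
      · exact enorm2_cont.continuousOn.log fun Z hZ => (enorm2_pos (hs Z hZ)).ne')
  refine ⟨C, fun Z hZ => ?_⟩
  have hn : ‖Z‖ ≠ 0 := norm_ne_zero_iff.mpr hZ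
  set c : ℂ := (‖Z‖ : ℂ) with hc
  have hc0 : c ≠ 0 := by simpa [hc] using hZ
  set W : ℂ × ℂ := c⁻¹ • Z with hW
  have hWs : W ∈ Metric.sphere (0 : ℂ × ℂ) 1 := by
    rw [mem_sphere_zero_iff_norm, hW, norm_smul, hc, norm_inv, Complex.norm_real, norm_norm,
      inv_mul_cancel₀ hn]
  have hZW : Z = c • W := by rw [hW, smul_inv_smul₀ hc0]
  have hF : Fmap F₀ F₁ Z = c ^ d • Fmap F₀ F₁ W := by
    rw [hZW]
    simp [Fmap, ev_smul h₀, ev_smul h₁]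
  have hb := hC W hWs
  have hW0 := hs W hWs
  have e1 : Real.log (enorm2 (Fmap F₀ F₁ Z))
      = d * Real.log ‖c‖ + Real.log (enorm2 (Fmap F₀ F₁ W)) := by
    rw [hF, enorm2_smul, Real.log_mul (by simpa using fun h => absurd h hc0)
      (enorm2_pos (hne W hW0)).ne', norm_pow, Real.log_pow]
  have e2 : Real.log (enorm2 Z) = Real.log ‖c‖ + Real.log (enorm2 W) := by
    conv_lhs => rw [hZW]
    rw [enorm2_smul, Real.log_mul (norm_ne_zero_iff.mpr hc0) (enorm2_pos hW0).ne']
  rw [e1, e2]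
  rw [Real.norm_eq_abs] at hb
  convert hb using 2
  ring

/-- The functions `Z ↦ d⁻ⁿ log ‖Fⁿ(Z)‖` converge uniformly on
`ℂ² ∖ {(0,0)}` to a continuous function `G^F` (the escaping rate function of `F`). -/
theorem stmt4 (d : ℕ) (hd : 2 ≤ d) (F₀ F₁ : MvPolynomial (Fin 2) ℂ)
    (h₀ : F₀.IsHomogeneous d) (h₁ : F₁.IsHomogeneous d)
    (hcz : ∀ Z : ℂ × ℂ, ev F₀ Z = 0 → ev F₁ Z = 0 → Z = 0) :
    ∃ G : ℂ × ℂ → ℝ, ContinuousOn G {Z : ℂ × ℂ | Z ≠ 0} ∧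
      TendstoUniformlyOn
        (fun (n : ℕ) (Z : ℂ × ℂ) => Real.log (enorm2 ((Fmap F₀ F₁)^[n] Z)) / (d : ℝ) ^ n)
        G atTop {Z : ℂ × ℂ | Z ≠ 0} := by
  have hne : ∀ Z : ℂ × ℂ, Z ≠ 0 → Fmap F₀ F₁ Z ≠ 0 := fun Z hZ h =>
    hZ (hcz Z (congrArg Prod.fst h) (congrArg Prod.snd h))
  have hne' : ∀ (n : ℕ) (Z : ℂ × ℂ), Z ≠ 0 → (Fmap F₀ F₁)^[n] Z ≠ 0 := by
    intro n
    induction n with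
    | zero => intro Z hZ; simpa using hZ
    | succ n ih => intro Z hZ; rw [Function.iterate_succ_apply']; exact hne _ (ih Z hZ)
  have hFc : Continuous (Fmap F₀ F₁) := (ev_cont F₀).prodMk (ev_cont F₁)
  obtain ⟨C, hC⟩ := Fmap_bound d F₀ F₁ h₀ h₁ hne
  have hd1 : (1 : ℝ) < d := by exact_mod_cast hd
  have hd0 : (0 : ℝ) < d := by linarith
  set u : ℕ → ℂ × ℂ → ℝ :=
    fun n Z => Real.log (enorm2 ((Fmap F₀ F₁)^[n] Z)) / (d : ℝ) ^ n with hu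
  have hdiff : ∀ (n : ℕ) (Z : ℂ × ℂ), Z ∈ {Z : ℂ × ℂ | Z ≠ 0} →
      ‖u (n + 1) Z - u n Z‖ ≤ C / d * (1 / d : ℝ) ^ n := by
    intro n Z hZ
    have h := hC _ (hne' n Z hZ)
    have e : u (n + 1) Z - u n Z = (Real.log (enorm2 (Fmap F₀ F₁ ((Fmap F₀ F₁)^[n] Z)))
        - d * Real.log (enorm2 ((Fmap F₀ F₁)^[n] Z))) / (d : ℝ) ^ (n + 1) := by
      simp only [hu, Function.iterate_succ_apply']
      field_simp
      ring
    rw [e, norm_div, Real.norm_eq_abs, Real.norm_of_nonneg (by positivity : (0:ℝ) ≤ d ^ (n + 1))]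
    have e2 : C / d * (1 / d : ℝ) ^ n = C / (d : ℝ) ^ (n + 1) := by
      rw [one_div, inv_pow]; field_simp; ring
    rw [e2]
    gcongr
  have hsum : Summable fun n : ℕ => C / d * (1 / d : ℝ) ^ n :=
    (summable_geometric_of_lt_one (by positivity) ((div_lt_one hd0).mpr hd1)).mul_left _
  have hT := tendstoUniformlyOn_tsum_nat hsum hdiff
  have hT2 : TendstoUniformlyOn u (fun Z => u 0 Z + ∑' n, (u (n + 1) Z - u n Z)) atTop
      {Z : ℂ × ℂ | Z ≠ 0} := by
    rw [Metric.tendstoUniformlyOn_iff] at hT ⊢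
    intro ε hε
    filter_upwards [hT ε hε] with n hn Z hZ
    have := hn Z hZ
    rw [Finset.sum_range_sub (fun n => u n Z)] at this
    rw [Real.dist_eq] at this ⊢
    convert this using 2
    ring
  refine ⟨_, hT2.continuousOn (Frequently.of_forall fun n => ?_), hT2⟩
  refine ContinuousOn.div_const ?_ _
  exact (enorm2_cont.comp (hFc.iterate n)).continuousOn.log
    fun Z hZ => (enorm2_pos (hne' n Z hZ)).ne'
end

section
/- Let P, Q ∈ ℂ[z] be coprime polynomials with max(deg P, deg Q) = 2, defining the quadratic rational function f = P/Q. Assume the fixed-point polynomial P(z) − z·Q(z) has degree 3, with roots w₁, w₂, w₃ ∈ ℂ listed with multiplicity, and that Q(wᵢ) ≠ 0 for i = 1,2,3; set μᵢ := f′(wᵢ), the derivative of f at wᵢ. Suppose z₁, z₂ ∈ ℂ satisfy z₁ ≠ z₂, Q(z₁) ≠ 0, Q(z₂) ≠ 0, f(z₁) = z₂ and f(z₂) = z₁ (a 2-cycle of f), and set λ := f′(z₁)·f′(z₂), the multiplier of the 2-cycle. Then (λ − 1)² = ((μ₁ + 1)(μ₂ + 1)(μ₃ + 1))². -/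
open Polynomial

theorem aux_mu (d u1 u2 u3 a q F : ℂ) (hd : d ≠ 0) (hq : q ≠ 0)
    (hF : F = a * (u2 - u1) * (u3 - u1))
    (hQ : d ^ 2 * q = a * u1 * (u1 + d) * (u2 * (u3 + d) + u3 * (u2 + d))) :
    1 + F / q + 1 = (u1 * (u2 + d) + u2 * (u1 + d)) * (u1 * (u3 + d) + u3 * (u1 + d)) /
      (u1 * (u1 + d) * (u2 * (u3 + d) + u3 * (u2 + d))) := by
  have h0 : a * u1 * (u1 + d) * (u2 * (u3 + d) + u3 * (u2 + d)) ≠ 0 := by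
    rw [← hQ]; positivity
  have h1 : u1 * (u1 + d) * (u2 * (u3 + d) + u3 * (u2 + d)) ≠ 0 := by
    intro h; apply h0; linear_combination a * h
  rw [eq_div_iff h1]
  have : F / q = d ^ 2 * F / (d ^ 2 * q) := by field_simp
  rw [this, hQ, hF]
  have h2 : d ^ 2 * (a * (u2 - u1) * (u3 - u1)) /
      (a * u1 * (u1 + d) * (u2 * (u3 + d) + u3 * (u2 + d))) *
      (u1 * (u1 + d) * (u2 * (u3 + d) + u3 * (u2 + d))) = d ^ 2 * (u2 - u1) * (u3 - u1) := by
    rw [div_mul_eq_mul_div, div_eq_iff h0]; ring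
  linear_combination h2

theorem aux_deriv (P Q : Polynomial ℂ) (a b c w₁ w₂ w₃ : ℂ)
    (hP : P = X * Q + C a * (X - C w₁) * (X - C w₂) * (X - C w₃))
    (hQ : Q = C (-a) * X ^ 2 + C b * X + C c) (z : ℂ) (hz : Q.eval z ≠ 0) :
    deriv (fun w : ℂ => P.eval w / Q.eval w) z =
      1 + a * ((z - w₁) * (z - w₂) + (z - w₁) * (z - w₃) + (z - w₂) * (z - w₃)) / Q.eval z
        - a * (z - w₁) * (z - w₂) * (z - w₃) * (-2 * a * z + b) / (Q.eval z) ^ 2 := by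
  have h := ((P.hasDerivAt z).fun_div (Q.hasDerivAt z) hz).deriv
  rw [h]
  have hQ' : Q.derivative.eval z = -2 * a * z + b := by
    rw [hQ]; simp; ring
  have hP' : P.derivative.eval z = Q.eval z + z * (-2 * a * z + b) +
      a * ((z - w₁) * (z - w₂) + (z - w₁) * (z - w₃) + (z - w₂) * (z - w₃)) := by
    rw [hP, ← hQ']; simp; ring
  have hP0 : P.eval z = z * Q.eval z + a * (z - w₁) * (z - w₂) * (z - w₃) := by
    rw [hP]; simp
  rw [hP', hQ', hP0]
  field_simp
  ring

/-- Let `f = P/Q` be a quadratic rational function with fixed-point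
polynomial `P − z·Q` of degree `3`, whose roots (with multiplicity) are `w₁, w₂, w₃`,
with fixed-point multipliers `μᵢ = f′(wᵢ)`.  If `{z₁, z₂}` is a 2-cycle of `f` with
multiplier `λ = f′(z₁)·f′(z₂)`, then `(λ − 1)² = ((μ₁+1)(μ₂+1)(μ₃+1))²`. -/
theorem stmt16 (P Q : Polynomial ℂ) (hcop : IsCoprime P Q)
    (hdeg : max P.natDegree Q.natDegree = 2)
    (hfixdeg : (P - Polynomial.X * Q).degree = 3)
    (a : ℂ) (ha : a ≠ 0) (w₁ w₂ w₃ : ℂ)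
    (hfac : P - Polynomial.X * Q =
      Polynomial.C a * (Polynomial.X - Polynomial.C w₁) * (Polynomial.X - Polynomial.C w₂) *
        (Polynomial.X - Polynomial.C w₃))
    (hQw₁ : Q.eval w₁ ≠ 0) (hQw₂ : Q.eval w₂ ≠ 0) (hQw₃ : Q.eval w₃ ≠ 0)
    (z₁ z₂ : ℂ) (hz : z₁ ≠ z₂) (hQz₁ : Q.eval z₁ ≠ 0) (hQz₂ : Q.eval z₂ ≠ 0)
    (hcyc₁ : P.eval z₁ / Q.eval z₁ = z₂) (hcyc₂ : P.eval z₂ / Q.eval z₂ = z₁) :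
    (deriv (fun w : ℂ => P.eval w / Q.eval w) z₁ *
        deriv (fun w : ℂ => P.eval w / Q.eval w) z₂ - 1) ^ 2 =
      ((deriv (fun w : ℂ => P.eval w / Q.eval w) w₁ + 1) *
        (deriv (fun w : ℂ => P.eval w / Q.eval w) w₂ + 1) *
        (deriv (fun w : ℂ => P.eval w / Q.eval w) w₃ + 1)) ^ 2 := by
  have hPd : P.natDegree ≤ 2 := hdeg ▸ le_max_left _ _
  have hQd : Q.natDegree ≤ 2 := hdeg ▸ le_max_right _ _
  have hP : P = X * Q + C a * (X - C w₁) * (X - C w₂) * (X - C w₃) := by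
    rw [← hfac]; ring
  have hQ2 : Q.coeff 2 = -a := by
    have h := congrArg (fun p => p.coeff 3) hfac
    have e : C a * (X - C w₁) * (X - C w₂) * (X - C w₃) =
      C a * X ^ 3 + C (-a * (w₁ + w₂ + w₃)) * X ^ 2 + C (a * (w₁ * w₂ + w₁ * w₃ + w₂ * w₃)) * X
        + C (-a * w₁ * w₂ * w₃) := by
      simp only [map_mul, map_add, map_neg]; ring
    simp only [e, coeff_sub, coeff_add, coeff_C_mul, coeff_X_pow, coeff_X, coeff_C] at h
    rw [coeff_eq_zero_of_natDegree_lt (by omega : P.natDegree < 3),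
      show (3 : ℕ) = 2 + 1 from rfl, coeff_X_mul] at h
    norm_num at h
    rw [← h]; ring
  obtain ⟨b, c, hQ⟩ : ∃ b c, Q = C (-a) * X ^ 2 + C b * X + C c := by
    refine ⟨Q.coeff 1, Q.coeff 0, ?_⟩
    rw [← hQ2]
    conv_lhs => rw [Q.as_sum_range_C_mul_X_pow' (by omega : Q.natDegree < 3)]
    simp [Finset.sum_range_succ]; ring
  have hQe : ∀ z, Q.eval z = -a * z ^ 2 + b * z + c := by intro z; rw [hQ]; simp
  have hPe : ∀ z, P.eval z = z * Q.eval z + a * (z - w₁) * (z - w₂) * (z - w₃) := by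
    intro z; rw [hP]; simp
  rw [div_eq_iff hQz₁, hPe] at hcyc₁
  rw [div_eq_iff hQz₂, hPe] at hcyc₂
  rw [aux_deriv P Q a b c w₁ w₂ w₃ hP hQ z₁ hQz₁, aux_deriv P Q a b c w₁ w₂ w₃ hP hQ z₂ hQz₂,
    aux_deriv P Q a b c w₁ w₂ w₃ hP hQ w₁ hQw₁, aux_deriv P Q a b c w₁ w₂ w₃ hP hQ w₂ hQw₂,
    aux_deriv P Q a b c w₁ w₂ w₃ hP hQ w₃ hQw₃]
  have hQe1 := hQe z₁
  have hQe2 := hQe z₂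
  have hQf1 := hQe w₁
  have hQf2 := hQe w₂
  have hQf3 := hQe w₃
  generalize Q.eval z₁ = q1 at *
  generalize Q.eval z₂ = q2 at *
  generalize Q.eval w₁ = r1 at *
  generalize Q.eval w₂ = r2 at *
  generalize Q.eval w₃ = r3 at *
  obtain ⟨d, rfl⟩ : ∃ d, z₂ = z₁ + d := ⟨z₂ - z₁, by ring⟩
  obtain ⟨u1, rfl⟩ : ∃ u, w₁ = z₁ - u := ⟨z₁ - w₁, by ring⟩
  obtain ⟨u2, rfl⟩ : ∃ u, w₂ = z₁ - u := ⟨z₁ - w₂, by ring⟩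
  obtain ⟨u3, rfl⟩ : ∃ u, w₃ = z₁ - u := ⟨z₁ - w₃, by ring⟩
  have hd : d ≠ 0 := by rintro rfl; simp at hz
  have e1 : d * q1 = a * (u1 * u2 * u3) := by linear_combination -hcyc₁
  have e2 : d * q2 = -a * ((u1 + d) * (u2 + d) * (u3 + d)) := by linear_combination hcyc₂
  have key : ∀ x r, r = -a * (z₁ - x) ^ 2 + b * (z₁ - x) + c →
      d * r = -a * d * x * (x + d) + q1 * (d + x) - q2 * x := by
    intro x r h; rw [h, hQe1, hQe2]; ring
  have k1 := key _ _ hQf1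
  have k2 := key _ _ hQf2
  have k3 := key _ _ hQf3
  have m1 := aux_mu d u1 u2 u3 a r1 _ hd hQw₁ rfl
    (by linear_combination d * k1 + (d + u1) * e1 - u1 * e2)
  have m2 := aux_mu d u2 u1 u3 a r2 _ hd hQw₂ rfl
    (by linear_combination d * k2 + (d + u2) * e1 - u2 * e2)
  have m3 := aux_mu d u3 u1 u2 a r3 _ hd hQw₃ rfl
    (by linear_combination d * k3 + (d + u3) * e1 - u3 * e2)
  have hb : d * (-2 * a * z₁ + b) = a * d ^ 2 + q2 - q1 := by rw [hQe1, hQe2]; ring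
  have hA : u1 * u2 * u3 ≠ 0 := by
    intro h; rw [h, mul_zero] at e1; exact mul_ne_zero hd hQz₁ e1
  have hB : (u1 + d) * (u2 + d) * (u3 + d) ≠ 0 := by
    intro h; rw [h, mul_zero] at e2; exact mul_ne_zero hd hQz₂ e2
  have hA1 : u1 ≠ 0 := by rintro rfl; simp at hA
  have hA2 : u2 ≠ 0 := by rintro rfl; simp at hA
  have hA3 : u3 ≠ 0 := by rintro rfl; simp at hA
  have hB1 : u1 + d ≠ 0 := by intro h; simp [h] at hB
  have hB2 : u2 + d ≠ 0 := by intro h; simp [h] at hB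
  have hB3 : u3 + d ≠ 0 := by intro h; simp [h] at hB
  have nz : ∀ x y z r, r ≠ 0 →
      d ^ 2 * r = a * x * (x + d) * (y * (z + d) + z * (y + d)) →
      y * (z + d) + z * (y + d) ≠ 0 := by
    intro x y z r hr h h0
    rw [h0, mul_zero] at h
    exact mul_ne_zero (pow_ne_zero 2 hd) hr h
  have s23 := nz u1 u2 u3 r1 hQw₁ (by linear_combination d * k1 + (d + u1) * e1 - u1 * e2)
  have s13 := nz u2 u1 u3 r2 hQw₂ (by linear_combination d * k2 + (d + u2) * e1 - u2 * e2)
  have s12 := nz u3 u1 u2 r3 hQw₃ (by linear_combination d * k3 + (d + u3) * e1 - u3 * e2)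
  have hq1 : q1 = a * (u1 * u2 * u3) / d := by rw [eq_div_iff hd]; linear_combination e1
  have hq2 : q2 = -a * ((u1 + d) * (u2 + d) * (u3 + d)) / d := by
    rw [eq_div_iff hd]; linear_combination e2
  have hb' : b = 2 * a * z₁ + (a * d ^ 2 + q2 - q1) / d := by
    field_simp; linear_combination hb
  have D1 : 1 + a * ((z₁ - (z₁ - u1)) * (z₁ - (z₁ - u2)) + (z₁ - (z₁ - u1)) * (z₁ - (z₁ - u3)) +
      (z₁ - (z₁ - u2)) * (z₁ - (z₁ - u3))) / q1 -
      a * (z₁ - (z₁ - u1)) * (z₁ - (z₁ - u2)) * (z₁ - (z₁ - u3)) * (-2 * a * z₁ + b) / q1 ^ 2 =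
      (3 * (u1 * u2 * u3) + 2 * d * (u1 * u2 + u1 * u3 + u2 * u3) + d ^ 2 * (u1 + u2 + u3)) /
        (u1 * u2 * u3) := by
    rw [hb', hq2, hq1]
    simp only [sub_sub_cancel]
    field_simp
    ring
  have D2 : 1 + a * ((z₁ + d - (z₁ - u1)) * (z₁ + d - (z₁ - u2)) +
      (z₁ + d - (z₁ - u1)) * (z₁ + d - (z₁ - u3)) +
      (z₁ + d - (z₁ - u2)) * (z₁ + d - (z₁ - u3))) / q2 -
      a * (z₁ + d - (z₁ - u1)) * (z₁ + d - (z₁ - u2)) * (z₁ + d - (z₁ - u3)) *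
        (-2 * a * (z₁ + d) + b) / q2 ^ 2 =
      (3 * ((u1 + d) * (u2 + d) * (u3 + d)) - 2 * d * ((u1 + d) * (u2 + d) + (u1 + d) * (u3 + d)
        + (u2 + d) * (u3 + d)) + d ^ 2 * ((u1 + d) + (u2 + d) + (u3 + d))) /
        ((u1 + d) * (u2 + d) * (u3 + d)) := by
    rw [hb', hq2, hq1]
    have t : ∀ u, z₁ + d - (z₁ - u) = u + d := by intro u; ring
    simp only [t]
    field_simp
    ring
  rw [D1, D2]
  have M1 := m1
  have g1 : ∀ x y z r : ℂ, 1 + a * ((z₁ - x - (z₁ - x)) * (z₁ - x - (z₁ - y)) +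
      (z₁ - x - (z₁ - x)) * (z₁ - x - (z₁ - z)) +
      (z₁ - x - (z₁ - y)) * (z₁ - x - (z₁ - z))) / r = 1 + a * (y - x) * (z - x) / r := by
    intro x y z r; ring
  have g2 : ∀ x y z r : ℂ, 1 + a * ((z₁ - x - (z₁ - y)) * (z₁ - x - (z₁ - x)) +
      (z₁ - x - (z₁ - y)) * (z₁ - x - (z₁ - z)) +
      (z₁ - x - (z₁ - x)) * (z₁ - x - (z₁ - z))) / r = 1 + a * (y - x) * (z - x) / r := by
    intro x y z r; ring
  have g3 : ∀ x y z r : ℂ, 1 + a * ((z₁ - x - (z₁ - y)) * (z₁ - x - (z₁ - z)) +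
      (z₁ - x - (z₁ - y)) * (z₁ - x - (z₁ - x)) +
      (z₁ - x - (z₁ - z)) * (z₁ - x - (z₁ - x))) / r = 1 + a * (y - x) * (z - x) / r := by
    intro x y z r; ring
  rw [g1 u1 u2 u3, g2 u2 u1 u3, g3 u3 u1 u2]
  simp only [sub_self, mul_zero, zero_mul, zero_div, sub_zero]
  rw [m1, m2, m3]
  congr 1
  have c21 : u2 * (u1 + d) + u1 * (u2 + d) = u1 * (u2 + d) + u2 * (u1 + d) := by ring
  have c31 : u3 * (u1 + d) + u1 * (u3 + d) = u1 * (u3 + d) + u3 * (u1 + d) := by ring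
  have c32 : u3 * (u2 + d) + u2 * (u3 + d) = u2 * (u3 + d) + u3 * (u2 + d) := by ring
  rw [c21, c31, c32]
  have R : ∀ p q r x y z : ℂ, p ≠ 0 → q ≠ 0 → r ≠ 0 → p * q / (x * r) * (p * r / (y * q)) *
      (q * r / (z * p)) = p * q * r / (x * y * z) := by
    intro p q r x y z hp hq hr
    field_simp
  rw [R _ _ _ _ _ _ s12 s13 s23, div_mul_div_comm, div_sub_one (mul_ne_zero hA hB),
    div_eq_div_iff (mul_ne_zero hA hB) (by simp [*])]
  ring
end
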